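/- Suppose s_0s_1s_0 = g_1⋯g_r in G = ℤ/2 * ℤ/3, where each g_i is a conjugate of s_1 = bwb. Then r ≥ 3, and a finite sequence of Hurwitz moves transforms the sequence (g_1,…,g_r) into a sequence (g_1',…,g_r') of conjugates of s_1 with g_1' = s_0, g_2' = s_1, g_3' = s_0, and g_4'⋯g_r' = 1. -/

import Mathlib

/-- `G = ℤ/2 * ℤ/3`, the free product of cyclic groups of orders 2 and 3
(isomorphic to `PSL(2,ℤ)`). -/
abbrev G23 := Monoid.Coprod (Multiplicative (ZMod 2)) (Multiplicative (ZMod 3))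

/-- The generator `w` of the `ℤ/2` factor. -/
def w : G23 := Monoid.Coprod.inl (Multiplicative.ofAdd (1 : ZMod 2))

/-- The generator `b` of the `ℤ/3` factor. -/
def b : G23 := Monoid.Coprod.inr (Multiplicative.ofAdd (1 : ZMod 3))

/-- `s₀ = wb²`. -/
def s0 : G23 := w * b ^ 2

/-- `s₁ = bwb`. -/
def s1 : G23 := b * w * b

/-- `s₂ = b²w`. -/
def s2 : G23 := b ^ 2 * w

/-- A single Hurwitz move on a finite sequence of elements of a group: some consecutive
pair `(a, b)` is replaced by `(b, b⁻¹ * a * b)` or by `(a * b * a⁻¹, a)`. -/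
def HurwitzMove {G : Type*} [Group G] (L L' : List G) : Prop :=
  ∃ (p : List G) (x y : G) (t : List G),
    L = p ++ x :: y :: t ∧
    (L' = p ++ y :: (y⁻¹ * x * y) :: t ∨ L' = p ++ (x * y * x⁻¹) :: x :: t)

/-- A finite sequence of Hurwitz moves. -/
def HurwitzEquiv {G : Type*} [Group G] : List G → List G → Prop :=
  Relation.ReflTransGen HurwitzMove

namespace G23

@[simp] theorem w_mul_w : w * w = 1 := by
  rw [w, ← map_mul]; exact map_one _

@[simp] theorem b_mul_b : b * b = b⁻¹ := by
  rw [b, ← map_mul, ← map_inv]; rfl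

@[simp] theorem w_inv : w⁻¹ = w := inv_eq_of_mul_eq_one_left w_mul_w

@[simp] theorem w_mul_w_mul (x : G23) : w * (w * x) = x := by rw [← mul_assoc, w_mul_w, one_mul]

@[simp] theorem b_mul_b_mul (x : G23) : b * (b * x) = b⁻¹ * x := by rw [← mul_assoc, b_mul_b]

@[simp] theorem b_inv_mul_b_inv : b⁻¹ * b⁻¹ = b := by rw [← mul_inv_rev, b_mul_b, inv_inv]

@[simp] theorem b_inv_mul_b_inv_mul (x : G23) : b⁻¹ * (b⁻¹ * x) = b * x := by
  rw [← mul_assoc, b_inv_mul_b_inv]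

theorem s0_eq : s0 = w * b⁻¹ := by rw [s0, pow_two, b_mul_b]

theorem s1_eq : s1 = b * (w * b) := by rw [s1, mul_assoc]

theorem s0_mul_s1 : s0 * s1 = b := by
  simp [s0_eq, s1_eq, mul_assoc]

theorem b_pow_three : b ^ 3 = 1 := by
  rw [pow_succ, pow_two, b_mul_b, inv_mul_cancel]

/-! ### Words -/

/-- Membership in the subgroup `⟨b⟩ = {1, b, b⁻¹}`. -/
def IsRot (c : G23) : Prop := c = 1 ∨ c = b ∨ c = b⁻¹

/-- `WordLen n u` says that `u` has an expression, not necessarily reduced, with `n`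
occurrences of `w`. -/
inductive WordLen : ℕ → G23 → Prop
  | rot {c : G23} : IsRot c → WordLen 0 c
  | step {n : ℕ} {c u : G23} : IsRot c → WordLen n u → WordLen (n + 1) (c * w * u)

/-- Reduced words in `b^{±1} w`. -/
inductive Tail : ℕ → G23 → Prop
  | one : Tail 0 1
  | step {n : ℕ} {c u : G23} : c = b ∨ c = b⁻¹ → Tail n u → Tail (n + 1) (c * w * u)

/-- Reduced conjugators of `s1`: rotations, and reduced words ending in `w`. -/
inductive Conjugator : ℕ → G23 → Prop
  | rot {c : G23} : IsRot c → Conjugator 0 c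
  | step {n : ℕ} {c u : G23} : IsRot c → Tail n u → Conjugator (n + 1) (c * w * u)

theorem IsRot.mul {c d : G23} (hc : IsRot c) (hd : IsRot d) : IsRot (c * d) := by
  rcases hc with rfl | rfl | rfl <;> rcases hd with rfl | rfl | rfl <;>
    simp [IsRot]

theorem IsRot.inv {c : G23} (hc : IsRot c) : IsRot c⁻¹ := by
  rcases hc with rfl | rfl | rfl <;> simp [IsRot]

theorem isRot_one : IsRot 1 := .inl rfl
theorem isRot_b : IsRot b := .inr (.inl rfl)
theorem isRot_b_inv : IsRot b⁻¹ := .inr (.inr rfl)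

theorem WordLen.rot_mul {n : ℕ} {c u : G23} (hc : IsRot c) (hu : WordLen n u) :
    WordLen n (c * u) := by
  cases hu with
  | rot hd => exact .rot (hc.mul hd)
  | step hd hu => simpa only [mul_assoc] using WordLen.step (hc.mul hd) hu

theorem WordLen.w_mul {n : ℕ} {u : G23} (hu : WordLen n u) : WordLen (n + 1) (w * u) := by
  simpa using WordLen.step isRot_one hu

theorem Tail.wordLen {n : ℕ} {u : G23} (hu : Tail n u) : WordLen n u := by
  induction hu with
  | one => exact .rot isRot_one
  | step hc _ ih => exact .step (.inr hc) ih

theorem Conjugator.wordLen {n : ℕ} {u : G23} (hu : Conjugator n u) : WordLen n u := by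
  cases hu with
  | rot hc => exact .rot hc
  | step hc hu => exact .step hc hu.wordLen

theorem Conjugator.isRot_or_exists_tail {n : ℕ} {u : G23} (hu : Conjugator n u) :
    IsRot u ∨ ∃ k c t, IsRot c ∧ Tail k t ∧ u = c * w * t := by
  cases hu with
  | rot hc => exact .inl hc
  | step hc ht => exact .inr ⟨_, _, _, hc, ht, rfl⟩

theorem exists_wordLen (g : G23) : ∃ n, WordLen n g := by
  suffices h : ∀ x, (∃ n, WordLen n x) → ∃ n, WordLen n (g * x) by
    simpa using h 1 ⟨0, .rot isRot_one⟩
  induction g using Monoid.Coprod.induction_on with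
  | inl m =>
    rintro x ⟨n, hx⟩
    have : (Monoid.Coprod.inl m : G23) = 1 ∨ (Monoid.Coprod.inl m : G23) = w := by
      have : m = 1 ∨ m = Multiplicative.ofAdd (1 : ZMod 2) := by revert m; decide
      rcases this with rfl | rfl
      · exact .inl (map_one _)
      · exact .inr rfl
    rcases this with h | h <;> rw [h]
    · exact ⟨n, by simpa using hx⟩
    · exact ⟨n + 1, hx.w_mul⟩
  | inr m =>
    rintro x ⟨n, hx⟩
    have : IsRot (Monoid.Coprod.inr m : G23) := by
      have : m = 1 ∨ m = Multiplicative.ofAdd (1 : ZMod 3) ∨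
          m = (Multiplicative.ofAdd (1 : ZMod 3))⁻¹ := by revert m; decide
      rcases this with rfl | rfl | rfl
      · exact .inl (map_one _)
      · exact .inr (.inl rfl)
      · exact .inr (.inr (map_inv _ _))
    exact ⟨n, hx.rot_mul this⟩
  | mul g h ihg ihh =>
    intro x hx
    simpa only [mul_assoc] using ihg _ (ihh _ hx)

/-- Every conjugate of `s1` has a reduced conjugator. -/
theorem WordLen.exists_conjugator {n : ℕ} {u : G23} (hu : WordLen n u) :
    ∃ k ≤ n, ∃ v, Conjugator k v ∧ u * s1 * u⁻¹ = v * s1 * v⁻¹ := by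
  induction hu with
  | rot hc => exact ⟨0, le_rfl, _, .rot hc, rfl⟩
  | @step n c u hc _ ih =>
    obtain ⟨k, hk, v, hv, e⟩ := ih
    have e' : c * w * u * s1 * (c * w * u)⁻¹ = c * w * v * s1 * (c * w * v)⁻¹ := by
      rw [show c * w * u * s1 * (c * w * u)⁻¹ = c * w * (u * s1 * u⁻¹) * (c * w)⁻¹ by group, e]
      group
    rw [e']
    cases hv with
    | rot hd =>
      rcases hd with rfl | rfl | rfl
      · exact ⟨1, by omega, _, .step hc .one, rfl⟩
      · refine ⟨0, by omega, c * b⁻¹, .rot (hc.mul isRot_b_inv), ?_⟩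
        simp [s1_eq, mul_assoc]
      · refine ⟨0, by omega, c * b, .rot (hc.mul isRot_b), ?_⟩
        simp [s1_eq, mul_assoc]
    | @step k d t hd ht =>
      rcases hd with rfl | hd
      · have e'' : c * w * (1 * w * t) = c * t := by simp [mul_assoc]
        rw [e'']
        cases ht with
        | one => exact ⟨0, by omega, _, .rot (hc.mul isRot_one), rfl⟩
        | @step j d t hd ht =>
          exact ⟨j + 1, by omega, _, .step (hc.mul (.inr hd)) ht, by simp only [mul_assoc]⟩
      · exact ⟨k + 2, by omega, _, .step hc (.step hd ht), rfl⟩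

/-! ### The action on the vertices of the trivalent tree -/

/-- The vertices `G23 ⧸ ⟨b⟩` of the trivalent tree. The base vertex is `none`, while
`some (e, l)` is the reduced word `b^e w b^{e₁} w ⋯ b^{eₙ} w`, where `l = [e₁, …, eₙ]`, `true`
stands for `b` and `false` for `b⁻¹`. -/
abbrev Vertex := Option (Option Bool × List Bool)

/-- The action of `w` on vertices. -/
def wAct : Vertex → Vertex
  | none => some (none, [])
  | some (none, []) => none
  | some (none, e :: l) => some (some e, l)
  | some (some e, l) => some (none, e :: l)

/-- The action of `b` on vertices. -/
def bAct : Vertex → Vertex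
  | none => none
  | some (none, l) => some (some true, l)
  | some (some true, l) => some (some false, l)
  | some (some false, l) => some (none, l)

/-- The action of `w` as a permutation. -/
def wPerm : Equiv.Perm Vertex :=
  Function.Involutive.toPerm wAct (by rintro (_ | ⟨_ | _, _ | _⟩) <;> rfl)

/-- The action of `b` as a permutation. -/
def bPerm : Equiv.Perm Vertex where
  toFun := bAct
  invFun x := bAct (bAct x)
  left_inv := by rintro (_ | ⟨_ | _ | _, _⟩) <;> rfl
  right_inv := by rintro (_ | ⟨_ | _ | _, _⟩) <;> rfl

theorem zmultiplesHom_ofMul_natCast {H : Type*} [Group H] {x : H} {n : ℕ} (hx : x ^ n = 1) :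
    zmultiplesHom (Additive H) (Additive.ofMul x) n = 0 := by
  rw [zmultiplesHom_apply, natCast_zsmul, ← ofMul_pow, hx, ofMul_one]

/-- The homomorphism from `G23` determined by images of `w` and `b` of orders dividing
`2` and `3`. -/
def homOf {H : Type*} [Group H] (x y : H) (hx : x ^ 2 = 1) (hy : y ^ 3 = 1) : G23 →* H :=
  Monoid.Coprod.lift
    (AddMonoidHom.toMultiplicativeLeft (ZMod.lift 2 ⟨zmultiplesHom (Additive H) (Additive.ofMul x),
      zmultiplesHom_ofMul_natCast hx⟩))
    (AddMonoidHom.toMultiplicativeLeft (ZMod.lift 3 ⟨zmultiplesHom (Additive H) (Additive.ofMul y),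
      zmultiplesHom_ofMul_natCast hy⟩))

theorem homOf_w {H : Type*} [Group H] (x y : H) (hx : x ^ 2 = 1) (hy : y ^ 3 = 1) :
    homOf x y hx hy w = x := by
  have := ZMod.lift_coe 2 ⟨zmultiplesHom (Additive H) (Additive.ofMul x),
      zmultiplesHom_ofMul_natCast hx⟩ 1
  simp only [Int.cast_one] at this
  simp [homOf, w, this]

theorem homOf_b {H : Type*} [Group H] (x y : H) (hx : x ^ 2 = 1) (hy : y ^ 3 = 1) :
    homOf x y hx hy b = y := by
  have := ZMod.lift_coe 3 ⟨zmultiplesHom (Additive H) (Additive.ofMul y),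
      zmultiplesHom_ofMul_natCast hy⟩ 1
  simp only [Int.cast_one] at this
  simp [homOf, b, this]

/-- The action of `G23` on vertices. -/
def act : G23 →* Equiv.Perm Vertex :=
  homOf wPerm bPerm
    (by ext1 x; rcases x with (_ | ⟨_ | _, _ | _⟩) <;> rfl)
    (by ext1 x; rcases x with (_ | ⟨_ | _ | _, _⟩) <;> rfl)

theorem act_w (x : Vertex) : act w x = wAct x := by rw [act, homOf_w]; rfl

theorem act_b (x : Vertex) : act b x = bAct x := by rw [act, homOf_b]; rfl

theorem act_b_inv (x : Vertex) : act b⁻¹ x = bAct (bAct x) := by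
  rw [← b_mul_b, map_mul, Equiv.Perm.mul_apply, act_b, act_b]

/-- The number of letters `w` in the reduced word of a vertex. -/
def height : Vertex → ℕ
  | none => 0
  | some (_, l) => l.length + 1

theorem IsRot.act_none {c : G23} (hc : IsRot c) : act c none = none := by
  rcases hc with rfl | rfl | rfl
  · simp
  · rw [act_b]; rfl
  · rw [act_b_inv]; rfl

theorem IsRot.height_act {c : G23} (hc : IsRot c) (x : Vertex) :
    height (act c x) = height x := by
  rcases hc with rfl | rfl | rfl
  · simp
  · rw [act_b]; rcases x with (_ | ⟨_ | _ | _, _⟩) <;> rfl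
  · rw [act_b_inv]; rcases x with (_ | ⟨_ | _ | _, _⟩) <;> rfl

/-- Elements that behave as reduced words starting and ending with `b^{±1}` when applied to
vertices whose reduced word starts with `w`. -/
def Good (m : G23) : Prop :=
  ∀ l : List Bool, ∃ e l', act m (some (none, l)) = some (some e, l') ∧ l.length ≤ l'.length

theorem good_b : Good b := fun l => ⟨true, l, by rw [act_b]; rfl, le_rfl⟩

theorem good_b_inv : Good b⁻¹ := fun l => ⟨false, l, by rw [act_b_inv]; rfl, le_rfl⟩

theorem good_rot {c : G23} (hc : c = b ∨ c = b⁻¹) : Good c := by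
  rcases hc with rfl | rfl
  exacts [good_b, good_b_inv]

theorem Good.exists_act_w_mul {m : G23} (hm : Good m) (l : List Bool) :
    ∃ l', act (w * m) (some (none, l)) = some (none, l') ∧ l.length < l'.length := by
  obtain ⟨e, l', h, hl⟩ := hm l
  exact ⟨e :: l', by rw [map_mul, Equiv.Perm.mul_apply, h, act_w]; rfl, by simp; omega⟩

theorem Good.mul_w_mul {m m' : G23} (hm : Good m) (hm' : Good m') : Good (m * w * m') := by
  intro l
  obtain ⟨l', h, hl⟩ := hm'.exists_act_w_mul l
  obtain ⟨e, l'', h', hl'⟩ := hm l'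
  exact ⟨e, l'', by rw [mul_assoc, map_mul, Equiv.Perm.mul_apply, h, h'], by omega⟩

theorem Tail.good_mul_b {n : ℕ} {u : G23} (hu : Tail n u) : Good (u * b) := by
  induction hu with
  | one => simpa using good_b
  | step hc _ ih => simpa only [mul_assoc] using (good_rot hc).mul_w_mul ih

theorem Tail.good_b_mul_inv {n : ℕ} {u : G23} (hu : Tail n u) : Good (b * u⁻¹) := by
  induction hu with
  | one => simpa using good_b
  | @step n c u hc _ ih =>
    have hinv : c⁻¹ = b ∨ c⁻¹ = b⁻¹ := by rcases hc with rfl | rfl <;> simp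
    simpa [mul_assoc] using ih.mul_w_mul (good_rot hinv)

/-! ### Pairs of conjugates -/

/-- For the pair `x = u s₁ u⁻¹`, `y = v s₁ v⁻¹`: either no `w` cancels between `x` and `y`, or one
of the two Hurwitz moves shortens a conjugator. -/
def Alternative (n : ℕ) (u : G23) (k : ℕ) (v : G23) : Prop :=
  Good (b * u⁻¹ * v * b) ∨ (∃ k' < k, WordLen k' (u * s1 * u⁻¹ * v)) ∨
    ∃ n' < n, WordLen n' (v * s1⁻¹ * v⁻¹ * u)

theorem Alternative.step {n k : ℕ} {u v c : G23} (hc : IsRot c) (h : Alternative n u k v) :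
    Alternative (n + 1) (c * w * u) (k + 1) (c * w * v) := by
  rcases h with h | ⟨k', hk, h⟩ | ⟨n', hn, h⟩
  · left; convert h using 1; group
  · right; left
    refine ⟨k' + 1, by omega, ?_⟩
    convert WordLen.step hc h using 1; group
  · right; right
    refine ⟨n' + 1, by omega, ?_⟩
    convert WordLen.step hc h using 1; group

theorem alternative_rot_step {k : ℕ} {c d v : G23} (hc : IsRot c) (hd : IsRot d) (hv : Tail k v) :
    Alternative 0 c (k + 1) (d * w * v) := by
  have h : b * c⁻¹ * d = b ∨ b * c⁻¹ * d = b⁻¹ ∨ d = c * b⁻¹ := by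
    rcases hc with rfl | rfl | rfl <;> rcases hd with rfl | rfl | rfl <;> simp
  rw [← or_assoc] at h
  rcases h with h | rfl
  · left
    simpa only [mul_assoc] using (good_rot h).mul_w_mul hv.good_mul_b
  · right; left
    refine ⟨k, by omega, ?_⟩
    convert hv.wordLen.rot_mul (hc.mul isRot_b) using 1
    simp [s1_eq, mul_assoc]

theorem alternative_step_rot {n : ℕ} {c d u : G23} (hc : IsRot c) (hd : IsRot d) (hu : Tail n u) :
    Alternative (n + 1) (c * w * u) 0 d := by
  have h : c⁻¹ * d * b = b ∨ c⁻¹ * d * b = b⁻¹ ∨ c = d * b := by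
    rcases hc with rfl | rfl | rfl <;> rcases hd with rfl | rfl | rfl <;> simp
  rw [← or_assoc] at h
  rcases h with h | rfl
  · left
    simpa [mul_assoc] using hu.good_b_mul_inv.mul_w_mul (good_rot h)
  · right; right
    refine ⟨n, by omega, ?_⟩
    convert hu.wordLen.rot_mul (hd.mul isRot_b_inv) using 1
    simp [s1_eq, mul_assoc]

theorem alternative_step_step_of_ne {n k : ℕ} {c d u v : G23} (hc : IsRot c) (hd : IsRot d)
    (hcd : c ≠ d) (hu : Tail n u) (hv : Tail k v) :
    Alternative (n + 1) (c * w * u) (k + 1) (d * w * v) := by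
  have h : c⁻¹ * d = b ∨ c⁻¹ * d = b⁻¹ := by
    rcases hc with rfl | rfl | rfl <;> rcases hd with rfl | rfl | rfl <;>
      simp at hcd ⊢
  left
  simpa [mul_assoc] using hu.good_b_mul_inv.mul_w_mul ((good_rot h).mul_w_mul hv.good_mul_b)

theorem Tail.alternative {n k : ℕ} {u v : G23} (hu : Tail n u) (hv : Tail k v) :
    Alternative n u k v := by
  induction hu generalizing k v with
  | one =>
    cases hv with
    | one => left; simpa using good_b_inv
    | step hd hv => exact alternative_rot_step isRot_one (.inr hd) hv
  | @step n c u hc hu ih =>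
    cases hv with
    | one => exact alternative_step_rot (.inr hc) isRot_one hu
    | @step k d v hd hv =>
      by_cases hcd : c = d
      · subst hcd; exact (ih hv).step (.inr hc)
      · exact alternative_step_step_of_ne (.inr hc) (.inr hd) hcd hu hv

theorem Conjugator.alternative {n k : ℕ} {u v : G23} (hu : Conjugator n u)
    (hv : Conjugator k v) : Alternative n u k v ∨ IsRot u ∧ v = u * b := by
  cases hu with
  | rot hc =>
    cases hv with
    | rot hd =>
      have h : b * u⁻¹ * v * b = b ∨ b * u⁻¹ * v * b = b⁻¹ ∨ v = u * b := by
        rcases hc with rfl | rfl | rfl <;> rcases hd with rfl | rfl | rfl <;> simp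
      rw [← or_assoc] at h
      exact h.imp (fun h => .inl (good_rot h)) fun h => ⟨hc, h⟩
    | step hd hv => exact .inl (alternative_rot_step hc hd hv)
  | @step n c u hc hu =>
    cases hv with
    | rot hd => exact .inl (alternative_step_rot hc hd hu)
    | @step k d v hd hv =>
      left
      by_cases hcd : c = d
      · subst hcd; exact (hu.alternative hv).step hc
      · exact alternative_step_step_of_ne hc hd hcd hu hv

/-! ### Canonical conjugators -/

/-- The least number of letters `w` in a conjugator taking `s1` to `g`. -/
noncomputable def depth (g : G23) : ℕ := sInf {n | ∃ u, WordLen n u ∧ g = u * s1 * u⁻¹}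

theorem depth_le {n : ℕ} {u g : G23} (hu : WordLen n u) (hg : g = u * s1 * u⁻¹) :
    depth g ≤ n := Nat.sInf_le ⟨u, hu, hg⟩

theorem exists_conjugator {g : G23} (hg : IsConj s1 g) :
    ∃ u, Conjugator (depth g) u ∧ g = u * s1 * u⁻¹ := by
  have hne : {n | ∃ u, WordLen n u ∧ g = u * s1 * u⁻¹}.Nonempty := by
    obtain ⟨u, hu⟩ := isConj_iff.1 hg
    obtain ⟨n, hn⟩ := exists_wordLen u
    exact ⟨n, u, hn, hu.symm⟩
  obtain ⟨u, hu, e⟩ := Nat.sInf_mem hne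
  obtain ⟨k, hk, v, hv, e'⟩ := hu.exists_conjugator
  have : depth g ≤ k := depth_le hv.wordLen (e.trans e')
  obtain rfl : k = depth g := le_antisymm hk this
  exact ⟨v, hv, by rw [e, e']⟩

open Classical in
/-- A reduced conjugator of minimal length taking `s1` to `g`. -/
noncomputable def conjugator (g : G23) : G23 :=
  if hg : IsConj s1 g then (exists_conjugator hg).choose else 1

theorem conjugator_spec {g : G23} (hg : IsConj s1 g) : Conjugator (depth g) (conjugator g) := by
  rw [conjugator, dif_pos hg]; exact (exists_conjugator hg).choose_spec.1

theorem eq_conjugator_mul {g : G23} (hg : IsConj s1 g) :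
    g = conjugator g * s1 * (conjugator g)⁻¹ := by
  rw [conjugator, dif_pos hg]; exact (exists_conjugator hg).choose_spec.2

theorem depth_rot_conj_le {c g : G23} (hc : IsRot c) (hg : IsConj s1 g) :
    depth (c * g * c⁻¹) ≤ depth g :=
  depth_le ((conjugator_spec hg).wordLen.rot_mul hc) (by
    nth_rewrite 1 [eq_conjugator_mul hg]; group)

/-- No letter `w` cancels between the consecutive factors `x` and `y`. -/
def GoodPair (x y : G23) : Prop := Good (b * (conjugator x)⁻¹ * conjugator y * b)

theorem exists_act_inv_mul_prod {x : G23} {L : List G23} (hL : ∀ g ∈ x :: L, IsConj s1 g)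
    (hch : (x :: L).IsChain GoodPair) :
    ∃ l, act ((conjugator x * b)⁻¹ * (x :: L).prod) none = some (none, l) ∧
      L.length ≤ l.length := by
  have key (P : G23) : (conjugator x * b)⁻¹ * (x * P) = w * (b * (conjugator x)⁻¹ * P) := by
    nth_rewrite 2 [eq_conjugator_mul (hL x (by simp))]
    simp [s1_eq, mul_assoc]
  induction L generalizing x with
  | nil =>
    rw [List.prod_cons, key, List.prod_nil, mul_one]
    rcases (conjugator_spec (hL x (by simp))).isRot_or_exists_tail with
      hc | ⟨k, c, t, hc, ht, hu⟩
    · refine ⟨[], ?_, le_rfl⟩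
      rw [map_mul, Equiv.Perm.mul_apply, (isRot_b.mul hc.inv).act_none, act_w]; rfl
    · obtain ⟨l, h, -⟩ := ht.good_b_mul_inv.exists_act_w_mul []
      refine ⟨l, ?_, Nat.zero_le _⟩
      rw [← h, hu]
      simp only [mul_inv_rev, map_mul, Equiv.Perm.mul_apply, hc.inv.act_none, w_inv]
      rw [act_w none]; rfl
  | cons y L ih =>
    rw [List.isChain_cons_cons] at hch
    have hy : IsConj s1 y := hL y (by simp)
    obtain ⟨l, h, hl⟩ := ih (fun g hg => hL g (List.mem_cons_of_mem _ hg)) hch.2 (by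
      intro P
      nth_rewrite 2 [eq_conjugator_mul hy]
      simp [s1_eq, mul_assoc])
    obtain ⟨l', h', hl'⟩ := Good.exists_act_w_mul hch.1 l
    refine ⟨l', ?_, by simp; omega⟩
    rw [← h', ← h, ← Equiv.Perm.mul_apply, ← map_mul, List.prod_cons, key]
    congr 2; group

/-- No cancellation of letters `w` happens in a product whose consecutive factors are good. -/
theorem length_le_height_act_prod {L : List G23} (hL : ∀ g ∈ L, IsConj s1 g)
    (hch : L.IsChain GoodPair) : L.length ≤ height (act L.prod none) := by
  cases L with
  | nil => simp
  | cons x L =>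
    obtain ⟨l, h, hl⟩ := exists_act_inv_mul_prod hL hch
    have e : act (x :: L).prod none = act (conjugator x * b) (some (none, l)) := by
      rw [← h, ← Equiv.Perm.mul_apply, ← map_mul, mul_inv_cancel_left]
    rw [e]
    rcases (conjugator_spec (hL x (by simp))).isRot_or_exists_tail with
      hc | ⟨k, c, t, hc, ht, hu⟩
    · rw [(hc.mul isRot_b).height_act]; simpa [height] using hl
    · obtain ⟨l', h', hl'⟩ := ht.good_mul_b.exists_act_w_mul l
      rw [hu, mul_assoc, mul_assoc, map_mul, Equiv.Perm.mul_apply, h', hc.height_act]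
      simp [height]; omega

end G23

/-! ### Hurwitz equivalence -/

section Hurwitz

variable {G : Type*} [Group G]

theorem HurwitzMove.append {L L' : List G} (h : HurwitzMove L L') (p t : List G) :
    HurwitzMove (p ++ L ++ t) (p ++ L' ++ t) := by
  obtain ⟨q, x, y, r, rfl, h⟩ := h
  refine ⟨p ++ q, x, y, r ++ t, by simp, ?_⟩
  rcases h with rfl | rfl
  · left; simp
  · right; simp

theorem HurwitzEquiv.append {L L' : List G} (h : HurwitzEquiv L L') (p t : List G) :
    HurwitzEquiv (p ++ L ++ t) (p ++ L' ++ t) :=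
  Relation.ReflTransGen.lift (fun L => p ++ L ++ t) (fun _ _ h => HurwitzMove.append h p t) _ _ h

theorem HurwitzEquiv.append_left {L L' : List G} (h : HurwitzEquiv L L') (p : List G) :
    HurwitzEquiv (p ++ L) (p ++ L') := by
  simpa using h.append p []

theorem HurwitzEquiv.append_right {L L' : List G} (h : HurwitzEquiv L L') (t : List G) :
    HurwitzEquiv (L ++ t) (L' ++ t) := h.append [] t

theorem HurwitzEquiv.of_eq {L L' : List G} (h : L = L') : HurwitzEquiv L L' := h ▸ .refl

theorem HurwitzEquiv.trans {L L' L'' : List G} (h : HurwitzEquiv L L') (h' : HurwitzEquiv L' L'') :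
    HurwitzEquiv L L'' := Relation.ReflTransGen.trans h h'

theorem hurwitzEquiv_right (p : List G) (x y : G) (t : List G) :
    HurwitzEquiv (p ++ x :: y :: t) (p ++ y :: (y⁻¹ * x * y) :: t) :=
  .single ⟨p, x, y, t, rfl, .inl rfl⟩

theorem hurwitzEquiv_left (p : List G) (x y : G) (t : List G) :
    HurwitzEquiv (p ++ x :: y :: t) (p ++ (x * y * x⁻¹) :: x :: t) :=
  .single ⟨p, x, y, t, rfl, .inr rfl⟩

theorem HurwitzEquiv.prod_eq {L L' : List G} (h : HurwitzEquiv L L') : L'.prod = L.prod := by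
  induction h with
  | refl => rfl
  | tail _ h ih =>
    rw [← ih]
    obtain ⟨p, x, y, t, rfl, rfl | rfl⟩ := h <;> simp [mul_assoc]

theorem HurwitzEquiv.length_eq {L L' : List G} (h : HurwitzEquiv L L') :
    L'.length = L.length := by
  induction h with
  | refl => rfl
  | tail _ h ih =>
    rw [← ih]
    obtain ⟨p, x, y, t, rfl, rfl | rfl⟩ := h <;> simp

theorem HurwitzEquiv.forall_isConj {L L' : List G} (h : HurwitzEquiv L L') {s : G}
    (hL : ∀ g ∈ L, IsConj s g) : ∀ g ∈ L', IsConj s g := by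
  induction h with
  | refl => exact hL
  | tail _ h ih =>
    obtain ⟨p, x, y, t, rfl, h⟩ := h
    have hx : IsConj s x := ih x (by simp)
    have hy : IsConj s y := ih y (by simp)
    have hx' : IsConj s (y⁻¹ * x * y) := hx.trans (isConj_iff.2 ⟨y⁻¹, by simp⟩)
    have hy' : IsConj s (x * y * x⁻¹) := hy.trans (isConj_iff.2 ⟨x, rfl⟩)
    simp only [List.mem_append, List.mem_cons] at ih
    rcases h with rfl | rfl <;> simp only [List.mem_append, List.mem_cons] <;>
      rintro g (hg | rfl | rfl | hg) <;> first | assumption | exact ih g (by simp [hg])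

theorem hurwitzEquiv_append_pair (p : List G) (x y : G) :
    HurwitzEquiv (p ++ [x, y]) ([x, y] ++ p.map fun g => (x * y)⁻¹ * g * (x * y)) := by
  induction p with
  | nil => exact .refl
  | cons g p ih =>
    refine (ih.append_left [g]).trans ?_
    refine (hurwitzEquiv_right [] g x _).trans ?_
    refine (hurwitzEquiv_right [x] _ y _).trans ?_
    exact .of_eq (by simp [mul_assoc])

theorem hurwitzEquiv_pair_append (x y g : G) :
    HurwitzEquiv [x, y, g] [x * y * g * (x * y)⁻¹, x, y] := by
  refine (hurwitzEquiv_left [x] y g []).trans ?_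
  refine (hurwitzEquiv_left [] x _ _).trans ?_
  exact .of_eq (by simp [mul_assoc])

theorem hurwitzEquiv_replicate_pair_append (x y g : G) (n : ℕ) :
    HurwitzEquiv ((List.replicate n [x, y]).flatten ++ [g])
      (((x * y) ^ n * g * ((x * y) ^ n)⁻¹) :: (List.replicate n [x, y]).flatten) := by
  induction n with
  | zero => exact .of_eq (by simp)
  | succ n ih =>
    rw [List.replicate_succ, List.flatten_cons, List.append_assoc]
    refine (ih.append_left [x, y]).trans ?_
    refine ((hurwitzEquiv_pair_append x y _).append_right
      (List.replicate n [x, y]).flatten).trans (.of_eq ?_)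
    simp [pow_succ', mul_assoc]

theorem prod_flatten_replicate_pair (x y : G) (n : ℕ) :
    (List.replicate n [x, y]).flatten.prod = (x * y) ^ n := by
  simp [List.prod_flatten]

end Hurwitz

namespace G23

theorem hurwitzEquiv_rot_pair {c x y : G23} (hc : IsRot c) (hx : x = c * s1 * c⁻¹)
    (hy : y = c * b * s1 * (c * b)⁻¹) : HurwitzEquiv [x, y] [s0, s1] := by
  subst hx hy
  rcases hc with rfl | rfl | rfl
  · exact (hurwitzEquiv_left [] _ _ []).trans (.of_eq (by simp [s0_eq, s1_eq, mul_assoc]))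
  · exact (hurwitzEquiv_right [] _ _ []).trans (.of_eq (by simp [s0_eq, s1_eq, mul_assoc]))
  · exact .of_eq (by simp [s0_eq, s1_eq, mul_assoc])

/-- The total number of letters `w` in the conjugators, plus the number of factors. -/
noncomputable def weight (L : List G23) : ℕ := (L.map fun g => depth g + 1).sum

theorem exists_append_of_not_isChain {α : Type*} {R : α → α → Prop} {L : List α}
    (h : ¬ L.IsChain R) :
    ∃ p x y t, L = p ++ x :: y :: t ∧ ¬ R x y := by
  induction L with
  | nil => simp at h
  | cons a L ih =>
    by_cases hL : L.IsChain R
    · cases L with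
      | nil => simp at h
      | cons c L => exact ⟨[], a, c, L, rfl, fun hac => h (.cons_cons hac hL)⟩
    · obtain ⟨p, x, y, t, rfl, hxy⟩ := ih hL
      exact ⟨a :: p, x, y, t, rfl, hxy⟩

theorem weight_map_rot_le {p : List G23} (hp : ∀ g ∈ p, IsConj s1 g) :
    weight (p.map fun g => b⁻¹ * g * b) ≤ weight p := by
  rw [weight, weight, List.map_map]
  refine List.sum_le_sum fun g hg => ?_
  simpa using depth_rot_conj_le isRot_b_inv (hp g hg)

theorem exists_hurwitzEquiv_replicate_append (L : List G23) (hL : ∀ g ∈ L, IsConj s1 g) :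
    ∃ k R, HurwitzEquiv L ((List.replicate k [s0, s1]).flatten ++ R) ∧
      (∀ g ∈ R, IsConj s1 g) ∧ R.IsChain GoodPair := by
  induction hN : weight L using Nat.strong_induction_on generalizing L with
  | _ N ih =>
  by_cases hch : L.IsChain GoodPair
  · exact ⟨0, L, .refl, hL, hch⟩
  obtain ⟨p, x, y, t, rfl, hxy⟩ := exists_append_of_not_isChain hch
  have of_equiv (L') (h : HurwitzEquiv (p ++ x :: y :: t) L') (hlt : weight L' < N) :
      ∃ k R, HurwitzEquiv (p ++ x :: y :: t) ((List.replicate k [s0, s1]).flatten ++ R) ∧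
        (∀ g ∈ R, IsConj s1 g) ∧ R.IsChain GoodPair := by
    obtain ⟨k, R, hR, h'⟩ := ih _ hlt L' (h.forall_isConj hL) rfl
    exact ⟨k, R, h.trans hR, h'⟩
  have hx : IsConj s1 x := hL x (by simp)
  have hy : IsConj s1 y := hL y (by simp)
  have ex := eq_conjugator_mul hx
  have ey := eq_conjugator_mul hy
  rcases (conjugator_spec hx).alternative (conjugator_spec hy) with
    (h | ⟨k, hk, h⟩ | ⟨n, hn, h⟩) | ⟨hu, hv⟩
  · exact absurd h hxy
  · refine of_equiv _ (hurwitzEquiv_left p x y t) ?_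
    have := depth_le (g := x * y * x⁻¹) h (by
      rw [← ex]; nth_rewrite 1 [ey]; simp only [mul_assoc, mul_inv_rev])
    simp [weight] at hN ⊢; omega
  · refine of_equiv _ (hurwitzEquiv_right p x y t) ?_
    have := depth_le (g := y⁻¹ * x * y) h (by
      rw [show conjugator y * s1⁻¹ * (conjugator y)⁻¹ = y⁻¹ by nth_rewrite 3 [ey]; group]
      nth_rewrite 1 [ex]; group)
    simp [weight] at hN ⊢; omega
  · have h1 : HurwitzEquiv (p ++ x :: y :: t)
        ([s0, s1] ++ ((p.map fun g => b⁻¹ * g * b) ++ t)) := by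
      have e := (hurwitzEquiv_rot_pair hu ex (hv ▸ ey)).append p t
      have e' := (hurwitzEquiv_append_pair p s0 s1).append_right t
      rw [s0_mul_s1] at e'
      simpa using e.trans e'
    have hL' := h1.forall_isConj hL
    have := weight_map_rot_le (p := p) fun g hg => hL g (by simp [hg])
    obtain ⟨k, R, hR, hgood⟩ := ih (weight ((p.map fun g => b⁻¹ * g * b) ++ t))
      (by simp [weight] at hN this ⊢; omega) _
      (fun g hg => hL' g (List.mem_append_right _ hg)) rfl
    refine ⟨k + 1, R, h1.trans ?_, hgood⟩
    simpa [List.replicate_succ] using hR.append_left [s0, s1]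

/-- The exponent sum of `b` modulo `3`. -/
def bExponent : G23 →* Multiplicative (ZMod 3) := homOf 1 (.ofAdd 1) (by decide) (by decide)

theorem bExponent_w : bExponent w = 1 := homOf_w ..

theorem bExponent_b : bExponent b = .ofAdd 1 := homOf_b ..

theorem isRot_b_pow (k : ℕ) : IsRot (b ^ k) := by
  induction k with
  | zero => simpa using isRot_one
  | succ k ih => rw [pow_succ]; exact ih.mul isRot_b

end G23

open G23 in
/-- **`PSL(2,ℤ)` normal factorization, Kodaira type III.**  If `s₀s₁s₀ = g₁⋯g_r` with each `gᵢ` a conjugate of `s₁`, then `r ≥ 3` and Hurwitz moves transform `(g₁,…,g_r)` into a sequence of conjugates of `s₁` beginning `s₀, s₁, s₀` with the remaining terms multiplying to `1`. -/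
theorem psl_normal_factorization_III (L : List G23)
    (hconj : ∀ g ∈ L, IsConj s1 g)
    (hprod : L.prod = s0 * s1 * s0) :
    3 ≤ L.length ∧
    ∃ L' : List G23, HurwitzEquiv L L' ∧ (∀ g ∈ L', IsConj s1 g) ∧
      L'.take 3 = [s0, s1, s0] ∧ (L'.drop 3).prod = 1 := by
  obtain ⟨k, R, hLR, hR, hch⟩ := exists_hurwitzEquiv_replicate_append L hconj
  have hp := hLR.prod_eq
  rw [hprod, List.prod_append, prod_flatten_replicate_pair, s0_mul_s1] at hp
  have hRprod : R.prod = (b ^ k)⁻¹ * (b * s0) := by rw [← hp, inv_mul_cancel_left]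
  have hheight : height (act R.prod none) = 1 := by
    rw [hRprod, s0_eq, map_mul, Equiv.Perm.mul_apply, (isRot_b_pow k).inv.height_act, map_mul,
      Equiv.Perm.mul_apply, isRot_b.height_act, map_mul, Equiv.Perm.mul_apply,
      isRot_b_inv.act_none, act_w]
    rfl
  have hlen : R.length ≤ 1 := hheight ▸ length_le_height_act_prod hR hch
  match R, hlen with
  | [], _ => simp [height] at hheight
  | [x], _ =>
    rw [List.prod_singleton] at hp
    have hk : k % 3 = 1 := by
      have hx : bExponent x = bExponent s1 :=
        (isConj_iff_eq.1 (bExponent.map_isConj (hR x (by simp)))).symm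
      have e := congrArg (fun g => (bExponent g).toAdd) hp
      simp only [map_mul, map_pow, hx, s0_eq, s1_eq, bExponent_w, bExponent_b, one_mul, map_inv,
        mul_inv_cancel, ← ofAdd_add, ← ofAdd_nsmul, toAdd_ofAdd, toAdd_one, nsmul_one] at e
      have e' : (k : ZMod 3) = (1 : ℕ) := by
        push_cast
        linear_combination e - (by decide : (3 : ZMod 3) = 0)
      exact (ZMod.natCast_eq_natCast_iff k 1 3).1 e'
    obtain ⟨m, rfl⟩ : ∃ m, k = 3 * m + 1 := ⟨k / 3, by omega⟩
    obtain rfl : x = s0 := by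
      rw [pow_succ, pow_mul, b_pow_three, one_pow, one_mul] at hp
      exact mul_left_cancel hp
    have h1 := hurwitzEquiv_replicate_pair_append s0 s1 s0 (3 * m)
    rw [s0_mul_s1, pow_mul, b_pow_three, one_pow, one_mul, inv_one, mul_one] at h1
    have h2 : HurwitzEquiv L ([s0, s1, s0] ++ (List.replicate (3 * m) [s0, s1]).flatten) := by
      refine hLR.trans ?_
      simpa [List.replicate_succ] using h1.append_left [s0, s1]
    refine ⟨?_, _, h2, h2.forall_isConj hconj, rfl, ?_⟩
    · rw [← h2.length_eq]; simp
    · change ((List.replicate (3 * m) [s0, s1]).flatten).prod = 1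
      rw [prod_flatten_replicate_pair, s0_mul_s1, pow_mul, b_pow_three, one_pow]
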